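/- Let R be a Gorenstein commutative noetherian local ring of Krull dimension d (i.e. R has finite injective dimension as a module over itself), and let M and N be nonzero finitely generated R-modules with M maximal Cohen–Macaulay (depth_R(M) = d). Fix a finite free presentation F₁ → F₀ → M → 0 and let T be its transpose (the cokernel of the induced map Hom_R(F₀,R) → Hom_R(F₁,R)). If Ext^j_R(T,N) = 0 for all 1 ≤ j ≤ d+1, then depth_R(M ⊗_R N) + depth R = depth_R(M) + depth_R(N). -/

import Mathlib

open CategoryTheory

universe u

/-- The `i`-th Ext module `Ext_R^i(M, N)` of `R`-modules `M` and `N`. -/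
noncomputable def extModule (R : Type u) [CommRing R] (M N : Type u)
    [AddCommGroup M] [Module R M] [AddCommGroup N] [Module R N] (i : ℕ) : ModuleCat.{u} R :=
  ((Ext R (ModuleCat.{u} R) i).obj (Opposite.op (ModuleCat.of R M))).obj (ModuleCat.of R N)

/-- The `i`-th Tor module `Tor^R_i(M, N)` of `R`-modules `M` and `N`. -/
noncomputable def torModule (R : Type u) [CommRing R] (M N : Type u)
    [AddCommGroup M] [Module R M] [AddCommGroup N] [Module R N] (i : ℕ) : ModuleCat.{u} R :=
  ((Tor (ModuleCat.{u} R) i).obj (ModuleCat.of R M)).obj (ModuleCat.of R N)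

/-- The depth of a module `M` over a local ring `R`:
`inf { i | Ext^i_R(k, M) ≠ 0 }` where `k` is the residue field, an element of `ℕ∞`
(the zero module has depth `⊤`, since the infimum of the empty set in `ℕ∞` is `⊤`). -/
noncomputable def moduleDepth (R : Type u) [CommRing R] [IsLocalRing R] (M : Type u)
    [AddCommGroup M] [Module R M] : ℕ∞ :=
  sInf {i : ℕ∞ | ∃ n : ℕ, i = (n : ℕ∞) ∧
    Nontrivial (extModule R (IsLocalRing.ResidueField R) M n)}

/-- A module `M` is totally reflexive if the canonical evaluation map `M → M**` is bijective
and `Ext^i_R(M, R) = 0 = Ext^i_R(M*, R)` for all `i > 0`. -/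
def IsTotallyReflexive (R : Type u) [CommRing R] (M : Type u)
    [AddCommGroup M] [Module R M] : Prop :=
  Function.Bijective (Module.Dual.eval R M) ∧
    (∀ i : ℕ, 0 < i → Subsingleton (extModule R M R i)) ∧
    (∀ i : ℕ, 0 < i → Subsingleton (extModule R (Module.Dual R M) R i))

/-- A module `P` has finite projective dimension iff for some `n`, `Ext^i_R(P, -)` vanishes
for all `i > n`. -/
def HasFiniteProjectiveDimension (R : Type u) [CommRing R] (P : Type u)
    [AddCommGroup P] [Module R P] : Prop :=
  ∃ n : ℕ, ∀ (N : Type u) [AddCommGroup N] [Module R N] (i : ℕ), n < i →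
    Subsingleton (extModule R P N i)

/-- A module `Q` has finite injective dimension iff for some `n`, `Ext^i_R(-, Q)` vanishes
for all `i > n`. -/
def HasFiniteInjectiveDimension (R : Type u) [CommRing R] (Q : Type u)
    [AddCommGroup Q] [Module R Q] : Prop :=
  ∃ n : ℕ, ∀ (N : Type u) [AddCommGroup N] [Module R N] (i : ℕ), n < i →
    Subsingleton (extModule R N Q i)

/-- `ExtVanishes R M N i` says that `Ext^i_R(M, N) = 0`, for the derived-category `Ext` groups. -/
abbrev ExtVanishes (R : Type u) [CommRing R] (M N : Type u)
    [AddCommGroup M] [Module R M] [AddCommGroup N] [Module R N] (i : ℕ) : Prop :=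
  Subsingleton (Abelian.Ext (ModuleCat.of R M) (ModuleCat.of R N) i)

section Ext

open Abelian Abelian.Ext

variable {R : Type u} [CommRing R]

theorem subsingleton_linearYonedaObj_homology_iff {X : ModuleCat.{u} R}
    (P : ProjectiveResolution X) (Y : ModuleCat.{u} R) (n : ℕ) :
    Subsingleton ((P.complex.linearYonedaObj R Y).homology n) ↔
      Subsingleton (Abelian.Ext X Y n) := by
  rw [← ModuleCat.isZero_iff_subsingleton, ← HomologicalComplex.exactAt_iff_isZero_homology]
  cases n with
  | zero =>
    rw [HomologicalComplex.exactAt_iff' _ 0 0 1 (by simp) (by simp),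
      ShortComplex.moduleCat_exact_iff]
    rw [Abelian.Ext.addEquiv₀.subsingleton_congr]
    have hd : (P.complex.linearYonedaObj R Y).d 0 0 = 0 :=
      HomologicalComplex.shape _ _ _ (by simp)
    constructor
    · intro h
      refine subsingleton_of_forall_eq 0 fun φ ↦ ?_
      obtain ⟨g, hg⟩ := h (P.π.f 0 ≫ φ : P.complex.X 0 ⟶ Y)
        ((P.complex_d_comp_π_f_zero_assoc φ).trans Limits.zero_comp)
      have h0 : P.π.f 0 ≫ φ = 0 := by
        rw [← hg]
        change ((P.complex.linearYonedaObj R Y).d 0 0) g = 0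
        rw [hd]
        rfl
      exact (cancel_epi (P.π.f 0)).mp (h0.trans Limits.comp_zero.symm)
    · intro h f hf
      refine ⟨0, ?_⟩
      obtain ⟨φ, hφ⟩ := Limits.CokernelCofork.IsColimit.desc' P.isColimitCokernelCofork
        (f : P.complex.X 0 ⟶ Y) hf
      have h0 : φ = 0 := h.elim φ (0 : X ⟶ Y)
      rw [map_zero, ← hφ, h0, Limits.comp_zero]
      rfl
  | succ n =>
    rw [HomologicalComplex.exactAt_iff' _ n (n + 1) (n + 2) (by simp) (by simp),
      ShortComplex.moduleCat_exact_iff]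
    constructor
    · intro h
      refine subsingleton_of_forall_eq 0 fun e ↦ ?_
      obtain ⟨f, hf, rfl⟩ := P.extMk_surjective e (n + 2) rfl
      rw [P.extMk_eq_zero_iff f (n + 2) rfl hf n rfl]
      exact h f hf
    · intro h f hf
      exact (P.extMk_eq_zero_iff f (n + 2) rfl hf n rfl).mp (Subsingleton.elim _ _)

theorem subsingleton_extModule_iff {M N : Type u}
    [AddCommGroup M] [Module R M] [AddCommGroup N] [Module R N] {i : ℕ} :
    Subsingleton (extModule R M N i) ↔ ExtVanishes R M N i := by
  let P := projectiveResolution (ModuleCat.of R M)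
  exact (P.isoExt i (ModuleCat.of R N) (R := R)).toLinearEquiv.toEquiv.subsingleton_congr.trans
    (subsingleton_linearYonedaObj_homology_iff P _ i)

variable {S : ShortComplex (ModuleCat.{u} R)}

theorem subsingleton_ext_X₃_of_covariant (hS : S.ShortExact) (X : ModuleCat.{u} R)
    {n : ℕ} (h₂ : Subsingleton (Abelian.Ext X S.X₂ n))
    (h₁ : Subsingleton (Abelian.Ext X S.X₁ (n + 1))) : Subsingleton (Abelian.Ext X S.X₃ n) := by
  refine subsingleton_of_forall_eq 0 fun e ↦ ?_
  obtain ⟨y, rfl⟩ := covariant_sequence_exact₃ X hS e rfl (Subsingleton.elim _ _)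
  rw [Subsingleton.elim y 0, zero_comp]

theorem subsingleton_ext_X₁_of_contravariant (hS : S.ShortExact) (X : ModuleCat.{u} R)
    {n : ℕ} (h₂ : Subsingleton (Abelian.Ext S.X₂ X n))
    (h₃ : Subsingleton (Abelian.Ext S.X₃ X (n + 1))) : Subsingleton (Abelian.Ext S.X₁ X n) := by
  refine subsingleton_of_forall_eq 0 fun e ↦ ?_
  obtain ⟨y, rfl⟩ := contravariant_sequence_exact₁ hS X e (add_comm 1 n) (Subsingleton.elim _ _)
  rw [Subsingleton.elim y 0, comp_zero]

theorem subsingleton_ext_X₂_of_contravariant (hS : S.ShortExact) (X : ModuleCat.{u} R)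
    {n : ℕ} (h₁ : Subsingleton (Abelian.Ext S.X₁ X n))
    (h₃ : Subsingleton (Abelian.Ext S.X₃ X n)) : Subsingleton (Abelian.Ext S.X₂ X n) := by
  refine subsingleton_of_forall_eq 0 fun e ↦ ?_
  obtain ⟨y, rfl⟩ := contravariant_sequence_exact₂ hS X e (Subsingleton.elim _ _)
  rw [Subsingleton.elim y 0, comp_zero]

theorem subsingleton_ext_X₃_of_contravariant (hS : S.ShortExact) (X : ModuleCat.{u} R)
    {n : ℕ} (h₁ : Subsingleton (Abelian.Ext S.X₁ X n))
    (h₂ : Subsingleton (Abelian.Ext S.X₂ X (n + 1))) :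
    Subsingleton (Abelian.Ext S.X₃ X (n + 1)) := by
  refine subsingleton_of_forall_eq 0 fun e ↦ ?_
  obtain ⟨y, rfl⟩ := contravariant_sequence_exact₃ hS X e (Subsingleton.elim _ _) (add_comm 1 n)
  rw [Subsingleton.elim y 0, comp_zero]

theorem shortExact_of_exact {A B C : Type u} [AddCommGroup A] [Module R A] [AddCommGroup B]
    [Module R B] [AddCommGroup C] [Module R C] {f : A →ₗ[R] B} {g : B →ₗ[R] C}
    (hf : Function.Injective f) (hg : Function.Surjective g) (hfg : Function.Exact f g) :
    (ModuleCat.shortComplexOfCompEqZero f g hfg.linearMap_comp_eq_zero).ShortExact where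
  exact := ModuleCat.shortComplex_exact _ hfg
  mono_f := (ModuleCat.mono_iff_injective _).mpr hf
  epi_g := (ModuleCat.epi_iff_surjective _).mpr hg

variable {X Y Z : Type u} [AddCommGroup X] [Module R X] [AddCommGroup Y] [Module R Y]
  [AddCommGroup Z] [Module R Z]

theorem extVanishes_zero_iff : ExtVanishes R X Y 0 ↔ Subsingleton (X →ₗ[R] Y) :=
  (Abelian.Ext.addEquiv₀.trans ModuleCat.homAddEquiv).toEquiv.subsingleton_congr

theorem extVanishes_succ_of_projective [Module.Projective R X] (i : ℕ) :
    ExtVanishes R X Y (i + 1) :=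
  subsingleton_of_forall_eq 0 fun e ↦ e.eq_zero_of_projective

theorem extVanishes_of_exact_of_projective [Module.Projective R Y] {f : X →ₗ[R] Y} {g : Y →ₗ[R] Z}
    (hf : Function.Injective f) (hg : Function.Surjective g) (hfg : Function.Exact f g)
    {N : Type u} [AddCommGroup N] [Module R N] {i : ℕ} (h : ExtVanishes R Z N (i + 2)) :
    ExtVanishes R X N (i + 1) :=
  subsingleton_ext_X₁_of_contravariant (shortExact_of_exact hf hg hfg) _
    (extVanishes_succ_of_projective (X := Y) i) h

theorem extVanishes_quotient_iff {x : R} (hx : x ∈ Module.annihilator R X)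
    (hreg : IsSMulRegular Y x) {g : Y →ₗ[R] Z} (hg : Function.Surjective g)
    (hxg : Function.Exact (LinearMap.lsmul R Y x) g) (i : ℕ) :
    ExtVanishes R X Z i ↔ ExtVanishes R X Y i ∧ ExtVanishes R X Y (i + 1) := by
  have hS := shortExact_of_exact (f := LinearMap.lsmul R Y x) hreg hg hxg
  have hzero (n : ℕ) (e : Abelian.Ext (ModuleCat.of R X) (ModuleCat.of R Y) n) :
      e.comp (mk₀ (ModuleCat.ofHom (LinearMap.lsmul R Y x))) (add_zero n) = 0 :=
    congr($(postcomp_smul_id_eq_zero_of_mem_annihilator (M := ModuleCat.of R Y)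
      (N := ModuleCat.of R X) hx n) e)
  refine ⟨fun h ↦ ⟨?_, ?_⟩, fun h ↦ subsingleton_ext_X₃_of_covariant hS _ h.1 h.2⟩
  · refine subsingleton_of_forall_eq 0 fun e ↦ ?_
    obtain ⟨y, rfl⟩ := covariant_sequence_exact₂ _ hS e (h.elim _ _)
    exact hzero i y
  · refine subsingleton_of_forall_eq 0 fun e ↦ ?_
    obtain ⟨y, rfl⟩ := covariant_sequence_exact₁ _ hS e (hzero _ e) rfl
    rw [h.elim y 0, zero_comp]

theorem extVanishes_of_quotient [IsNoetherianRing R] [IsLocalRing R] [Module.Finite R X]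
    [Module.Finite R Y] {x : R} (hx : x ∈ IsLocalRing.maximalIdeal R)
    (hreg : IsSMulRegular X x) {g : X →ₗ[R] Z} (hg : Function.Surjective g)
    (hxg : Function.Exact (LinearMap.lsmul R X x) g) {i : ℕ} (h : ExtVanishes R Z Y (i + 1)) :
    ExtVanishes R X Y i := by
  have hS := shortExact_of_exact (f := LinearMap.lsmul R X x) hreg hg hxg
  have htop : (⊤ : Submodule R (Abelian.Ext (ModuleCat.of R X) (ModuleCat.of R Y) i)) ≤
      IsLocalRing.maximalIdeal R • ⊤ := by
    intro e _
    obtain ⟨y, rfl⟩ := contravariant_sequence_exact₁ hS _ e (add_comm 1 i) (h.elim _ _)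
    have : (mk₀ (ModuleCat.ofHom (LinearMap.lsmul R X x))).comp y (zero_add i) = x • y := by
      change (mk₀ (x • 𝟙 (ModuleCat.of R X))).comp y (zero_add i) = x • y
      simp [mk₀_smul]
    change (mk₀ (ModuleCat.ofHom (LinearMap.lsmul R X x))).comp y (zero_add i) ∈ _
    rw [this]
    exact Submodule.smul_mem_smul hx trivial
  exact (Submodule.subsingleton_iff R).mp (subsingleton_of_bot_eq_top
    (Submodule.eq_bot_of_le_smul_of_le_jacobson_bot _ _ Module.Finite.fg_top htop
      (IsLocalRing.maximalIdeal_le_jacobson _)).symm)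

theorem exists_extension_of_extVanishes {f : X →ₗ[R] Y} {g : Y →ₗ[R] Z}
    (hf : Function.Injective f) (hg : Function.Surjective g) (hfg : Function.Exact f g)
    {N : Type u} [AddCommGroup N] [Module R N] (h : ExtVanishes R Z N 1) (φ : X →ₗ[R] N) :
    ∃ ψ : Y →ₗ[R] N, ψ ∘ₗ f = φ := by
  have hS := shortExact_of_exact hf hg hfg
  obtain ⟨y, hy⟩ := contravariant_sequence_exact₁ hS (ModuleCat.of R N)
    (mk₀ (ModuleCat.ofHom φ)) rfl (h.elim _ _)
  obtain ⟨ψ, rfl⟩ := (mk₀_bijective _ _).surjective y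
  rw [mk₀_comp_mk₀] at hy
  exact ⟨ψ.hom, congr(ModuleCat.Hom.hom $((mk₀_bijective _ _).injective hy))⟩

theorem exists_lift_of_extVanishes {f : X →ₗ[R] Y} {g : Y →ₗ[R] Z}
    (hf : Function.Injective f) (hg : Function.Surjective g) (hfg : Function.Exact f g)
    {N : Type u} [AddCommGroup N] [Module R N] (h : ExtVanishes R N X 1) (φ : N →ₗ[R] Z) :
    ∃ ψ : N →ₗ[R] Y, g ∘ₗ ψ = φ := by
  have hS := shortExact_of_exact hf hg hfg
  obtain ⟨y, hy⟩ := covariant_sequence_exact₃ (ModuleCat.of R N) hS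
    (mk₀ (ModuleCat.ofHom φ)) rfl (h.elim _ _)
  obtain ⟨ψ, rfl⟩ := (mk₀_bijective _ _).surjective y
  rw [mk₀_comp_mk₀] at hy
  exact ⟨ψ.hom, congr(ModuleCat.Hom.hom $((mk₀_bijective _ _).injective hy))⟩

end Ext

section Depth

open IsLocalRing Pointwise

variable {R : Type u} [CommRing R]

theorem ExtVanishes.of_linearEquiv {X Y Z : Type u} [AddCommGroup X] [Module R X]
    [AddCommGroup Y] [Module R Y] [AddCommGroup Z] [Module R Z] (e : X ≃ₗ[R] Y) {i : ℕ}
    (h : ExtVanishes R Y Z i) : ExtVanishes R X Z i := by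
  refine subsingleton_of_forall_eq 0 fun a ↦ ?_
  rw [← Abelian.Ext.mk₀_id_comp a, ← e.toModuleIso.hom_inv_id, ← Abelian.Ext.mk₀_comp_mk₀,
    Abelian.Ext.comp_assoc _ _ _ (zero_add 0) (zero_add i) (by lia),
    h.elim ((Abelian.Ext.mk₀ e.toModuleIso.inv).comp a (zero_add i)) 0, Abelian.Ext.comp_zero]

theorem ExtVanishes.of_linearEquiv_right {X Y Z : Type u} [AddCommGroup X] [Module R X]
    [AddCommGroup Y] [Module R Y] [AddCommGroup Z] [Module R Z] (e : Y ≃ₗ[R] Z) {i : ℕ}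
    (h : ExtVanishes R X Y i) : ExtVanishes R X Z i := by
  refine subsingleton_of_forall_eq 0 fun a ↦ ?_
  rw [← a.comp_mk₀_id, ← e.toModuleIso.inv_hom_id, ← Abelian.Ext.mk₀_comp_mk₀,
    ← Abelian.Ext.comp_assoc _ _ _ (add_zero i) (add_zero 0) (by lia),
    h.elim (a.comp (Abelian.Ext.mk₀ e.toModuleIso.inv) (add_zero i)) 0, Abelian.Ext.zero_comp]

theorem nontrivial_quotSMulTop [IsLocalRing R] (X : Type u) [AddCommGroup X] [Module R X]
    [Module.Finite R X] [Nontrivial X] {x : R} (hx : x ∈ maximalIdeal R) :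
    Nontrivial (QuotSMulTop x X) :=
  Submodule.Quotient.nontrivial_iff.mpr <| Ne.symm <|
    Submodule.top_ne_pointwise_smul_of_mem_jacobson_annihilator
      (maximalIdeal_le_jacobson _ hx)

variable [IsLocalRing R]

theorem annihilator_residueField : Module.annihilator R (ResidueField R) = maximalIdeal R :=
  Ideal.annihilator_quotient

instance isSimpleModule_residueField : IsSimpleModule R (ResidueField R) :=
  isSimpleModule_iff_isCoatom.mpr (maximalIdeal.isMaximal R).out

/-- `HasDepth R X n` says that `n` is the least `i` with `Ext^i_R(k, X) ≠ 0`, where `k` is the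
residue field of `R`. -/
def HasDepth (R : Type u) [CommRing R] [IsLocalRing R] (X : Type u) [AddCommGroup X] [Module R X]
    (n : ℕ) : Prop :=
  (∀ i < n, ExtVanishes R (ResidueField R) X i) ∧ ¬ ExtVanishes R (ResidueField R) X n

variable {X Y Z : Type u} [AddCommGroup X] [Module R X] [AddCommGroup Y] [Module R Y]
  [AddCommGroup Z] [Module R Z]

theorem HasDepth.moduleDepth_eq {n : ℕ} (h : HasDepth R X n) : moduleDepth R X = n := by
  apply le_antisymm
  · exact sInf_le ⟨n, rfl, not_subsingleton_iff_nontrivial.mp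
      fun hs ↦ h.2 (subsingleton_extModule_iff.mp hs)⟩
  · refine le_sInf ?_
    rintro _ ⟨m, rfl, hm⟩
    rw [Nat.cast_le]
    by_contra! hlt
    exact not_subsingleton_iff_nontrivial.mpr hm (subsingleton_extModule_iff.mpr (h.1 m hlt))

theorem extVanishes_residueField_zero_of_isSMulRegular {x : R} (hx : x ∈ maximalIdeal R)
    (hreg : IsSMulRegular Y x) : ExtVanishes R (ResidueField R) Y 0 :=
  extVanishes_zero_iff.mpr
    (hreg.linearMap_subsingleton_of_mem_annihilator (annihilator_residueField (R := R) ▸ hx))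

theorem exists_isSMulRegular_of_extVanishes [IsNoetherianRing R] [Module.Finite R Y]
    (h : ExtVanishes R (ResidueField R) Y 0) :
    ∃ x ∈ maximalIdeal R, IsSMulRegular Y x := by
  rw [extVanishes_zero_iff, IsSMulRegular.subsingleton_linearMap_iff,
    annihilator_residueField] at h
  exact h

theorem forall_lt_succ_extVanishes_iff {x : R} (hx : x ∈ maximalIdeal R)
    (hreg : IsSMulRegular Y x) {g : Y →ₗ[R] Z} (hg : Function.Surjective g)
    (hxg : Function.Exact (LinearMap.lsmul R Y x) g) (n : ℕ) :
    (∀ i < n + 1, ExtVanishes R (ResidueField R) Y i) ↔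
      ∀ i < n, ExtVanishes R (ResidueField R) Z i := by
  have key := extVanishes_quotient_iff (annihilator_residueField (R := R) ▸ hx) hreg hg hxg
  constructor
  · exact fun h i hi ↦ (key i).mpr ⟨h i (by lia), h (i + 1) (by lia)⟩
  · rintro h (_ | i) hi
    · exact extVanishes_residueField_zero_of_isSMulRegular hx hreg
    · exact ((key i).mp (h i (by lia))).2

theorem hasDepth_succ_iff {x : R} (hx : x ∈ maximalIdeal R)
    (hreg : IsSMulRegular Y x) {g : Y →ₗ[R] Z} (hg : Function.Surjective g)
    (hxg : Function.Exact (LinearMap.lsmul R Y x) g) (n : ℕ) :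
    HasDepth R Y (n + 1) ↔ HasDepth R Z n := by
  have key := extVanishes_quotient_iff (annihilator_residueField (R := R) ▸ hx) hreg hg hxg n
  rw [HasDepth, HasDepth, forall_lt_succ_extVanishes_iff hx hreg hg hxg, key]
  refine and_congr_right fun h ↦ ?_
  have := (forall_lt_succ_extVanishes_iff hx hreg hg hxg n).mpr h n (by lia)
  tauto

theorem exists_maximal_nonvanishing_ext [IsNoetherianRing R] {Q : Type u} [AddCommGroup Q]
    [Module R Q] [Module.Finite R Q] [Nontrivial Q] (hQ : HasFiniteInjectiveDimension R Q) :
    ∃ t : ℕ, ¬ ExtVanishes R (ResidueField R) Q t ∧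
      ∀ (X : Type u) [AddCommGroup X] [Module R X] [Module.Finite R X] (i : ℕ), t < i →
        ExtVanishes R X Q i := by
  classical
  have hex : ∃ n : ℕ, ∀ (X : Type u) [AddCommGroup X] [Module R X] [Module.Finite R X] (i : ℕ),
      n ≤ i → ExtVanishes R X Q i := by
    obtain ⟨n, hn⟩ := hQ
    exact ⟨n + 1, fun X _ _ _ i hi ↦ subsingleton_extModule_iff.mp (hn X i hi)⟩
  obtain ⟨t, ht⟩ : ∃ t, Nat.find hex = t + 1 := by
    refine Nat.exists_eq_succ_of_ne_zero fun h0 ↦ ?_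
    have := extVanishes_zero_iff.mp (Nat.find_spec hex R 0 h0.le)
    have := (LinearMap.ringLmapEquivSelf R R Q).symm.injective.subsingleton
    exact not_subsingleton Q this
  have hvan (X : Type u) [AddCommGroup X] [Module R X] [Module.Finite R X] (i : ℕ) (hi : t < i) :
      ExtVanishes R X Q i := Nat.find_spec hex X i (by lia)
  refine ⟨t, fun hk ↦ ?_, hvan⟩
  refine Nat.find_min hex (m := t) (by lia) fun X _ _ _ i hi ↦ ?_
  obtain rfl | hlt := hi.eq_or_lt
  swap
  · exact hvan X i hlt
  induction ‹Module.Finite R X› using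
      IsNoetherianRing.induction_on_isQuotientEquivQuotientPrime R with
  | subsingleton N =>
    have h0 : 𝟙 (ModuleCat.of R N) = 0 := by
      ext y
      exact Subsingleton.elim (α := N) _ _
    refine subsingleton_of_forall_eq 0 fun a ↦ ?_
    rw [← Abelian.Ext.mk₀_id_comp a, h0, Abelian.Ext.mk₀_zero, Abelian.Ext.zero_comp]
  | quotient N p e =>
    by_cases hp : p.1 = maximalIdeal R
    · exact hk.of_linearEquiv (e.trans (Submodule.quotEquivOfEq _ _ hp))
    · obtain ⟨x, hx, hxp⟩ := SetLike.exists_of_lt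
        ((IsLocalRing.le_maximalIdeal p.2.ne_top).lt_of_ne hp)
      have hreg : IsSMulRegular N x := by
        rw [e.isSMulRegular_congr, isSMulRegular_iff_right_eq_zero_of_smul]
        intro a ha
        obtain ⟨a, rfl⟩ := Ideal.Quotient.mk_surjective a
        rw [Algebra.smul_def, Ideal.Quotient.algebraMap_eq, ← map_mul,
          Ideal.Quotient.eq_zero_iff_mem] at ha
        exact Ideal.Quotient.eq_zero_iff_mem.mpr ((p.2.mem_or_mem ha).resolve_left hxp)
      exact extVanishes_of_quotient hx hreg (Submodule.mkQ_surjective _)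
        (LinearMap.exact_lsmul_mkQ_smul_top N x) (hvan (QuotSMulTop x N) _ (by lia))
  | exact N₁ N₂ N₃ f g hf hg hfg h₁ h₃ =>
    exact subsingleton_ext_X₂_of_contravariant (shortExact_of_exact hf hg hfg) _ h₁ h₃

theorem not_extVanishes_of_not_extVanishes_residueField {Q : Type u} [AddCommGroup Q] [Module R Q]
    [Module.Finite R X] {t : ℕ}
    (ht : ¬ ExtVanishes R (ResidueField R) Q t)
    (hvan : ∀ (W : Type u) [AddCommGroup W] [Module R W] [Module.Finite R W] (i : ℕ), t < i →
        ExtVanishes R W Q i)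
    (hX : ¬ ExtVanishes R (ResidueField R) X 0) : ¬ ExtVanishes R X Q t := by
  intro h
  rw [extVanishes_zero_iff, not_subsingleton_iff_nontrivial] at hX
  obtain ⟨f, hf⟩ := exists_ne (0 : ResidueField R →ₗ[R] X)
  have hS := shortExact_of_exact (f.injective_of_ne_zero hf) (Submodule.mkQ_surjective _)
    (LinearMap.exact_map_mkQ_range f)
  exact ht (subsingleton_ext_X₁_of_contravariant hS _ h (hvan (X ⧸ f.range) _ (by lia)))

/-- Over a noetherian local ring, if `Q` has injective dimension `t`, then every nonzero finite
module `X` has finite depth, and `depth X + sup {i | Ext^i(X, Q) ≠ 0} = t`. -/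
theorem exists_hasDepth [IsNoetherianRing R] {Q : Type u} [AddCommGroup Q]
    [Module R Q] [Module.Finite R Q] {t : ℕ}
    (ht : ¬ ExtVanishes R (ResidueField R) Q t)
    (hvan : ∀ (W : Type u) [AddCommGroup W] [Module R W] [Module.Finite R W] (i : ℕ), t < i →
        ExtVanishes R W Q i)
    (X : Type u) [AddCommGroup X] [Module R X] [Module.Finite R X] [Nontrivial X] :
    ∃ n i : ℕ, HasDepth R X n ∧ i + n = t ∧ ¬ ExtVanishes R X Q i ∧
      ∀ j, i < j → ExtVanishes R X Q j := by
  suffices H : ∀ (K : Submodule R X) (Z : Type u) [AddCommGroup Z] [Module R Z] [Nontrivial Z]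
      (g : X →ₗ[R] Z), Function.Surjective g → g.ker = K → ∃ n i : ℕ, HasDepth R Z n ∧
      i + n = t ∧ ¬ ExtVanishes R Z Q i ∧ ∀ j, i < j → ExtVanishes R Z Q j from
    H _ X LinearMap.id Function.surjective_id rfl
  intro K
  induction K using WellFoundedGT.induction with
  | ind K ih =>
    rintro Z _ _ _ g hg rfl
    have : Module.Finite R Z := Module.Finite.of_surjective g hg
    by_cases hZ : ExtVanishes R (ResidueField R) Z 0
    · obtain ⟨x, hx, hreg⟩ := exists_isSMulRegular_of_extVanishes hZ
      have := nontrivial_quotSMulTop Z hx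
      have hp := Submodule.mkQ_surjective (x • (⊤ : Submodule R Z))
      have hex := LinearMap.exact_lsmul_mkQ_smul_top Z x
      have hlt : g.ker < ((x • (⊤ : Submodule R Z)).mkQ ∘ₗ g).ker := by
        refine lt_of_le_of_ne (LinearMap.ker_le_ker_comp _ _) fun heq ↦ ?_
        obtain ⟨z, hz⟩ := exists_ne (0 : Z)
        obtain ⟨y, rfl⟩ := hg z
        have hy : x • y ∈ ((x • (⊤ : Submodule R Z)).mkQ ∘ₗ g).ker := by
          rw [LinearMap.mem_ker, LinearMap.comp_apply, map_smul]
          exact hex.apply_apply_eq_zero (g y)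
        rw [← heq, LinearMap.mem_ker, map_smul] at hy
        exact hz (hreg.right_eq_zero_of_smul hy)
      obtain ⟨n, i, hn, hi, hne, hv⟩ := ih _ hlt (QuotSMulTop x Z) _ (hp.comp hg) rfl
      obtain _ | i := i
      · have h0 := extVanishes_zero_iff.mp (extVanishes_of_quotient hx hreg hp hex (hv 1 one_pos))
        refine absurd (extVanishes_zero_iff.mpr ⟨fun a b ↦ ?_⟩) hne
        exact (LinearMap.cancel_right hp).mp (h0.elim _ _)
      · refine ⟨n + 1, i, (hasDepth_succ_iff hx hreg hp hex n).mpr hn, by lia, fun h ↦ hne ?_,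
          fun j hj ↦ extVanishes_of_quotient hx hreg hp hex (hv (j + 1) (by lia))⟩
        have hS := shortExact_of_exact (f := LinearMap.lsmul R Z x) hreg hp hex
        exact subsingleton_ext_X₃_of_contravariant hS _ h
          (extVanishes_of_quotient hx hreg hp hex (hv (i + 2) (by lia)))
    · exact ⟨0, t, ⟨by simp, hZ⟩, rfl,
        not_extVanishes_of_not_extVanishes_residueField ht hvan hZ, fun j hj ↦ hvan Z j hj⟩

theorem HasDepth.le_ringKrullDim [IsNoetherianRing R] {n : ℕ} (h : HasDepth R R n) :
    (n : WithBot ℕ∞) ≤ ringKrullDim R := by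
  obtain ⟨rs, hlen, -, hreg⟩ := ModuleCat.exists_isRegular_of_exists_subsingleton_ext
    (maximalIdeal R) n (ModuleCat.of R R)
    (by simpa using (maximalIdeal.isMaximal R).ne_top.lt_top) (ModuleCat.of R (ResidueField R))
    (by
      change Module.support R (ResidueField R) = _
      rw [Module.support_eq_zeroLocus, annihilator_residueField]) h.1
  have : Nontrivial (R ⧸ Ideal.ofList rs) := Ideal.Quotient.nontrivial_iff.mpr fun htop ↦
    hreg.top_ne_smul (by rw [htop, Submodule.top_smul])
  rw [← ringKrullDim_add_length_eq_ringKrullDim_of_isRegular rs hreg, hlen]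
  exact le_add_of_nonneg_left ringKrullDim_nonneg_of_nontrivial

theorem nontrivial_linearMap_residueField [IsNoetherianRing R] (S : Type u) [AddCommGroup S]
    [Module R S] [Module.Finite R S] [Nontrivial S] : Nontrivial (S →ₗ[R] ResidueField R) := by
  rw [← not_subsingleton_iff_nontrivial, IsSMulRegular.subsingleton_linearMap_iff]
  rintro ⟨r, hr, hreg⟩
  by_cases hm : r ∈ maximalIdeal R
  · have := hreg.linearMap_subsingleton_of_mem_annihilator (N := ResidueField R)
      (annihilator_residueField (R := R) ▸ hm)
    exact one_ne_zero (α := ResidueField R)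
      congr($(Subsingleton.elim (LinearMap.id : ResidueField R →ₗ[R] ResidueField R) 0) 1)
  · obtain ⟨s, hs⟩ := exists_ne (0 : S)
    have hu : IsUnit r := by simpa using hm
    exact hs (hu.smul_eq_zero.mp (Module.mem_annihilator.mp hr s))

theorem nontrivial_tensorProduct [IsNoetherianRing R] (M N : Type u) [AddCommGroup M] [Module R M]
    [Module.Finite R M] [Nontrivial M] [AddCommGroup N] [Module R N] [Module.Finite R N]
    [Nontrivial N] : Nontrivial (TensorProduct R M N) := by
  have := nontrivial_linearMap_residueField (R := R) M
  have := nontrivial_linearMap_residueField (R := R) N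
  obtain ⟨p, hp⟩ := exists_ne (0 : M →ₗ[R] ResidueField R)
  obtain ⟨q, hq⟩ := exists_ne (0 : N →ₗ[R] ResidueField R)
  obtain ⟨x, hx⟩ := DFunLike.ne_iff.mp hp
  obtain ⟨y, hy⟩ := DFunLike.ne_iff.mp hq
  refine ⟨TensorProduct.tmul R x y, 0, fun h ↦ mul_ne_zero hx hy ?_⟩
  simpa using congr(TensorProduct.lift ((LinearMap.mul R (ResidueField R)).compl₁₂ p q) $h)

theorem not_extVanishes_hom [IsNoetherianRing R] {S N : Type u} [AddCommGroup S] [Module R S]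
    [AddCommGroup N] [Module R N] [Module.Finite R S] [Nontrivial S]
    (h : ¬ ExtVanishes R (ResidueField R) N 0) :
    ¬ ExtVanishes R (ResidueField R) (S →ₗ[R] N) 0 := by
  rw [extVanishes_zero_iff, not_subsingleton_iff_nontrivial] at h ⊢
  obtain ⟨f, hf⟩ := exists_ne (0 : ResidueField R →ₗ[R] N)
  have := nontrivial_linearMap_residueField (R := R) S
  obtain ⟨p, hp⟩ := exists_ne (0 : S →ₗ[R] ResidueField R)
  obtain ⟨s, hs⟩ := DFunLike.ne_iff.mp hp
  refine ⟨⟨((LinearMap.mul R (ResidueField R)).compl₂ p).compr₂ f, 0, fun heq ↦ hs ?_⟩⟩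
  have h1 : f (1 * p s) = 0 := congr($heq 1 s)
  exact f.injective_of_ne_zero hf (by rw [← one_mul (p s), h1]; simp)

/-- If `Ext^j(S, N) = 0` for `1 ≤ j ≤ q`, then `Hom(S, N)` and `N` have the same depth as long as
`depth N ≤ q`, and `Hom(S, N)` has depth at least `q + 1` when `N` does. -/
theorem depth_hom_of_extVanishes [IsNoetherianRing R] {S : Type u} [AddCommGroup S] [Module R S]
    [Module.Finite R S] [Nontrivial S] (n q : ℕ) (N : Type u)
    [AddCommGroup N] [Module R N] [Module.Finite R N]
    (hSN : ∀ j, 1 ≤ j → j ≤ q → ExtVanishes R S N j) :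
    (n ≤ q + 1 → (∀ i < n, ExtVanishes R (ResidueField R) N i) →
      ∀ i < n, ExtVanishes R (ResidueField R) (S →ₗ[R] N) i) ∧
    (n ≤ q → HasDepth R N n → HasDepth R (S →ₗ[R] N) n) := by
  induction n generalizing q N with
  | zero => exact ⟨by simp, fun _ h ↦ ⟨by simp, not_extVanishes_hom h.2⟩⟩
  | succ n ih =>
    by_cases h0 : ExtVanishes R (ResidueField R) N 0
    swap
    · exact ⟨fun _ h ↦ absurd (h 0 (by lia)) h0, fun _ h ↦ absurd (h.1 0 (by lia)) h0⟩
    obtain ⟨x, hx, hreg⟩ := exists_isSMulRegular_of_extVanishes h0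
    have hregH : IsSMulRegular (S →ₗ[R] N) x := fun a b hab ↦
      LinearMap.ext fun s ↦ hreg congr($hab s)
    obtain _ | q := q
    · refine ⟨fun hn _ i hi ↦ ?_, fun hn ↦ by lia⟩
      obtain rfl : i = 0 := by lia
      exact extVanishes_residueField_zero_of_isSMulRegular hx hregH
    have hp := Submodule.mkQ_surjective (x • (⊤ : Submodule R N))
    have hex := LinearMap.exact_lsmul_mkQ_smul_top N x
    have hS := shortExact_of_exact (f := LinearMap.lsmul R N x) hreg hp hex
    specialize ih q (QuotSMulTop x N) fun j h1 hj ↦ subsingleton_ext_X₃_of_covariant hS _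
      (hSN j h1 (by lia)) (hSN (j + 1) (by lia) (by lia))
    have hpH : Function.Surjective (LinearMap.compRight R (M := S) (x • (⊤ : Submodule R N)).mkQ) :=
      exists_lift_of_extVanishes (f := LinearMap.lsmul R N x) hreg hp hex (hSN 1 le_rfl (by lia))
    have hexH : Function.Exact (LinearMap.lsmul R (S →ₗ[R] N) x)
        (LinearMap.compRight R (M := S) (x • (⊤ : Submodule R N)).mkQ) := by
      intro φ
      constructor
      · intro hφ
        choose ψ hψ using fun s ↦ (hex (φ s)).mp congr($hφ s)
        refine ⟨{ toFun := ψ, map_add' := fun a b ↦ hreg ?_, map_smul' := fun r a ↦ hreg ?_ },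
          LinearMap.ext hψ⟩
        · simp_all
        · simp_all [smul_comm x r]
      · rintro ⟨ψ, rfl⟩
        exact LinearMap.ext fun s ↦ hex.apply_apply_eq_zero (ψ s)
    rw [forall_lt_succ_extVanishes_iff hx hreg hp hex,
      forall_lt_succ_extVanishes_iff hx hregH hpH hexH, hasDepth_succ_iff hx hreg hp hex,
      hasDepth_succ_iff hx hregH hpH hexH]
    exact ⟨fun hn ↦ ih.1 (by lia), fun hn ↦ ih.2 (by lia)⟩

theorem HasDepth.of_linearEquiv {n : ℕ} (e : X ≃ₗ[R] Y) (h : HasDepth R Y n) :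
    HasDepth R X n :=
  ⟨fun i hi ↦ (h.1 i hi).of_linearEquiv_right e.symm, fun hX ↦ h.2 (hX.of_linearEquiv_right e)⟩

end Depth

section TensorDual

variable {R : Type u} [CommRing R]

section Cokernel

variable {A B C N : Type u} [AddCommGroup A] [Module R A] [AddCommGroup B] [Module R B]
  [AddCommGroup C] [Module R C] [AddCommGroup N] [Module R N] {α : A →ₗ[R] B} {β : B →ₗ[R] C}

theorem exact_rangeRestrict (hαβ : Function.Exact α β) : Function.Exact α β.rangeRestrict :=
  fun b ↦ by rw [← LinearMap.mem_ker, LinearMap.ker_rangeRestrict, LinearMap.mem_ker, hαβ b]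

theorem extVanishes_of_cokernel [Module.Projective R B] [Module.Projective R C]
    (hα : Function.Injective α) (hαβ : Function.Exact α β) {i : ℕ}
    (h : ExtVanishes R (C ⧸ β.range) N (i + 3)) : ExtVanishes R A N (i + 1) :=
  extVanishes_of_exact_of_projective hα β.surjective_rangeRestrict (exact_rangeRestrict hαβ) <|
    extVanishes_of_exact_of_projective (Submodule.subtype_injective _)
      (Submodule.mkQ_surjective _) (LinearMap.exact_subtype_mkQ β.range) h

theorem exists_extension_of_extVanishes_cokernel [Module.Projective R C]
    (hα : Function.Injective α) (hαβ : Function.Exact α β)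
    (h : ExtVanishes R (C ⧸ β.range) N 2) (φ : A →ₗ[R] N) : ∃ ψ : B →ₗ[R] N, ψ ∘ₗ α = φ :=
  exists_extension_of_extVanishes hα β.surjective_rangeRestrict (exact_rangeRestrict hαβ)
    (extVanishes_of_exact_of_projective (Submodule.subtype_injective _)
      (Submodule.mkQ_surjective _) (LinearMap.exact_subtype_mkQ β.range) h) φ

theorem exists_factorization_of_extVanishes_cokernel (hαβ : Function.Exact α β)
    (h : ExtVanishes R (C ⧸ β.range) N 1) {φ : B →ₗ[R] N} (hφ : φ ∘ₗ α = 0) :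
    ∃ ψ : C →ₗ[R] N, ψ ∘ₗ β = φ := by
  have hker : β.ker ≤ φ.ker := fun b hb ↦ by
    obtain ⟨a, rfl⟩ := (hαβ b).mp hb
    exact congr($hφ a)
  obtain ⟨ψ, hψ⟩ := exists_extension_of_extVanishes (Submodule.subtype_injective _)
    (Submodule.mkQ_surjective _) (LinearMap.exact_subtype_mkQ β.range) h
    (β.ker.liftQ φ hker ∘ₗ β.quotKerEquivRange.symm.toLinearMap)
  refine ⟨ψ, LinearMap.ext fun b ↦ ?_⟩
  simpa using congr($hψ ⟨β b, LinearMap.mem_range_self β b⟩)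

end Cokernel

/-- The natural map `X ⊗ N → Hom(X*, N)` sending `x ⊗ n` to `φ ↦ φ x • n`. -/
noncomputable def tensorToHomDual (R X N : Type u) [CommRing R] [AddCommGroup X] [Module R X]
    [AddCommGroup N] [Module R N] : TensorProduct R X N →ₗ[R] Module.Dual R X →ₗ[R] N :=
  dualTensorHom R (Module.Dual R X) N ∘ₗ (Module.Dual.eval R X).rTensor N

variable {M N F₀ F₁ : Type u} [AddCommGroup M] [Module R M] [AddCommGroup N] [Module R N]
  [AddCommGroup F₀] [Module R F₀] [AddCommGroup F₁] [Module R F₁]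

theorem tensorToHomDual_rTensor (g : F₀ →ₗ[R] M) (z : TensorProduct R F₀ N) :
    tensorToHomDual R M N (g.rTensor N z) = tensorToHomDual R F₀ N z ∘ₗ g.dualMap := by
  induction z with
  | zero => simp
  | add a b ha hb => simp [ha, hb, LinearMap.add_comp]
  | tmul x n => ext φ; simp [tensorToHomDual]

theorem bijective_tensorToHomDual [Module.Free R F₀] [Module.Finite R F₀] :
    Function.Bijective (tensorToHomDual R F₀ N) :=
  ((dualTensorHomEquiv (R := R) (M := Module.Dual R F₀) (N := N)).bijective).comp
    (LinearEquiv.rTensor N (Module.evalEquiv R F₀)).bijective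

variable {f : F₁ →ₗ[R] F₀} {g : F₀ →ₗ[R] M}

theorem exact_dualMap (hg : Function.Surjective g) (hfg : Function.Exact f g) :
    Function.Exact g.dualMap f.dualMap :=
  LinearMap.exact_lcomp_of_exact_of_surjective R hfg hg

theorem bijective_tensorToHomDual_of_extVanishes [Module.Free R F₀] [Module.Finite R F₀]
    [Module.Free R F₁] [Module.Finite R F₁] (hg : Function.Surjective g)
    (hfg : Function.Exact f g)
    (h₁ : ExtVanishes R (Module.Dual R F₁ ⧸ f.dualMap.range) N 1)
    (h₂ : ExtVanishes R (Module.Dual R F₁ ⧸ f.dualMap.range) N 2) :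
    Function.Bijective (tensorToHomDual R M N) := by
  have hex := exact_dualMap hg hfg
  constructor
  · rw [injective_iff_map_eq_zero]
    intro w hw
    obtain ⟨z, rfl⟩ := LinearMap.rTensor_surjective N hg w
    rw [tensorToHomDual_rTensor] at hw
    obtain ⟨ψ, hψ⟩ := exists_factorization_of_extVanishes_cokernel hex h₁ hw
    obtain ⟨y, rfl⟩ := (bijective_tensorToHomDual (F₀ := F₁)).surjective ψ
    rw [← tensorToHomDual_rTensor] at hψ
    rw [← bijective_tensorToHomDual.injective hψ, ← LinearMap.comp_apply,
      ← LinearMap.rTensor_comp, hfg.linearMap_comp_eq_zero, LinearMap.rTensor_zero,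
      LinearMap.zero_apply]
  · intro h
    obtain ⟨ψ, rfl⟩ := exists_extension_of_extVanishes_cokernel
      (LinearMap.dualMap_injective_of_surjective hg) hex h₂ h
    obtain ⟨z, rfl⟩ := bijective_tensorToHomDual.surjective ψ
    exact ⟨g.rTensor N z, tensorToHomDual_rTensor g z⟩

end TensorDual

/-- The maximal Cohen-Macaulay case of the main theorem: over a Gorenstein noetherian local
ring `R` of Krull dimension `d` (i.e. `R` has finite injective dimension over itself), if `M`,
`N` are nonzero finitely generated with `M` maximal Cohen-Macaulay, and the transpose `T` of a
finite free presentation of `M` satisfies `Ext^j_R(T, N) = 0` for `1 ≤ j ≤ d + 1`, then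
`depth(M ⊗ N) + depth R = depth M + depth N`. -/
theorem depth_formula_of_mcm_gorenstein
    (R : Type u) [CommRing R] [IsNoetherianRing R] [IsLocalRing R]
    (d : ℕ) (hdim : ringKrullDim R = d)
    (hGor : HasFiniteInjectiveDimension R R)
    (M N : Type u) [AddCommGroup M] [Module R M] [Module.Finite R M] [Nontrivial M]
    [AddCommGroup N] [Module R N] [Module.Finite R N] [Nontrivial N]
    (hMCM : moduleDepth R M = (d : ℕ∞))
    (F₀ F₁ : Type u)
    [AddCommGroup F₀] [Module R F₀] [Module.Free R F₀] [Module.Finite R F₀]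
    [AddCommGroup F₁] [Module R F₁] [Module.Free R F₁] [Module.Finite R F₁]
    (f : F₁ →ₗ[R] F₀) (g : F₀ →ₗ[R] M)
    (hg : Function.Surjective g) (hfg : LinearMap.range f = LinearMap.ker g)
    (hExt : ∀ j : ℕ, 1 ≤ j → j ≤ d + 1 →
      Subsingleton (extModule R
        (Module.Dual R F₁ ⧸ LinearMap.range (LinearMap.dualMap f)) N j)) :
    moduleDepth R (TensorProduct R M N) + moduleDepth R R =
      moduleDepth R M + moduleDepth R N := by
  have hEx : Function.Exact f g := LinearMap.exact_iff.mpr hfg.symm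
  have hT (j : ℕ) (h₁ : 1 ≤ j) (h₂ : j ≤ d + 1) :
      ExtVanishes R (Module.Dual R F₁ ⧸ f.dualMap.range) N j :=
    subsingleton_extModule_iff.mp (hExt j h₁ h₂)
  obtain ⟨t, ht, hvan⟩ := exists_maximal_nonvanishing_ext hGor
  obtain ⟨m, iR, hR, hm, hiR, -⟩ := exists_hasDepth ht hvan R
  obtain rfl : iR = 0 := by
    cases iR with
    | zero => rfl
    | succ i => exact absurd (extVanishes_succ_of_projective i) hiR
  obtain ⟨m', iM, hM, hm', -, -⟩ := exists_hasDepth ht hvan M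
  have hm'd : m' = d := by
    rw [hM.moduleDepth_eq] at hMCM
    exact_mod_cast hMCM
  have hmd : m ≤ d := by
    have := hR.le_ringKrullDim
    rw [hdim] at this
    exact_mod_cast this
  obtain ⟨n, iN, hN, hn, -, -⟩ := exists_hasDepth ht hvan N
  have := nontrivial_tensorProduct (R := R) M N
  obtain ⟨l, iL, hL, hl, -, -⟩ := exists_hasDepth ht hvan (TensorProduct R M N)
  rw [hL.moduleDepth_eq, hR.moduleDepth_eq, hM.moduleDepth_eq, hN.moduleDepth_eq,
    show m = m' by lia, add_comm]
  suffices l = n by rw [this]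
  obtain _ | q := d
  · lia
  let e := LinearEquiv.ofBijective (tensorToHomDual R M N)
    (bijective_tensorToHomDual_of_extVanishes hg hEx (hT 1 (by lia) (by lia))
      (hT 2 (by lia) (by lia)))
  have : Nontrivial (Module.Dual R M) := by
    by_contra! h
    exact not_subsingleton _ e.toEquiv.subsingleton
  have hdual := depth_hom_of_extVanishes (S := Module.Dual R M) n q N fun j h₁ h₂ ↦ by
    obtain ⟨i, rfl⟩ := Nat.exists_eq_add_of_le' h₁
    exact extVanishes_of_cokernel (LinearMap.dualMap_injective_of_surjective hg)
      (exact_dualMap hg hEx) (hT _ (by lia) (by lia))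
  have hge : n ≤ l := by
    by_contra! hlt
    exact hL.2 ((hdual.1 (by lia) hN.1 l hlt).of_linearEquiv_right e.symm)
  obtain hnq | hnq := le_or_gt n q
  · have := ((hdual.2 hnq hN).of_linearEquiv e).moduleDepth_eq
    rw [hL.moduleDepth_eq] at this
    exact_mod_cast this
  · lia
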